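/- Let κ_v, a_v, σ_v, κ_f, a_f, σ_f > 0, θ_v, θ_f ≥ 0 and ρ_{sf}, ρ_{vf} ∈ (−1,1). For x = (x₁,x₂) ∈ ℝ² define b(x) = ( κ_v(a_v − x₁), κ_f(a_f − x₂) − σ_f·ρ_{sf}·√(x₁x₂)·1_{(0,∞)}(min(x₁,x₂)) ) and, for s ∈ ℝ, u = (u₁,u₂) ∈ ℝ², define g(s,u,x) ∈ ℝ² by g₁(s,u,x) = θ_v·s·1_{(0,∞)}(s) + σ_v·u₁·√x₁·1_{(0,∞)}(x₁) and g₂(s,u,x) = θ_f·s·1_{(0,∞)}(s) + σ_f·ρ_{vf}·u₁·√x₂·1_{(0,∞)}(x₂) + σ_f·√(1−ρ_{vf}²)·u₂·√x₂·1_{(0,∞)}(x₂). Then there exists a constant C > 0 such that for every x ∈ ℝ² one has 2⟨x, b(x)⟩ + ∫_{ℝ³} |g(s,u,x)|² dν₂(s,u) ≤ C(1 + |x|²), where ⟨·,·⟩ and |·| are the Euclidean inner product and norm on ℝ². (This is the non-explosion growth condition for the coupled variance/foreign-rate system.) -/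

import Mathlib

open MeasureTheory Real Set

/-- The Gamma Lévy density `g_γ(s) = (α/s)·e^{−βs}` for `s > 0`, `0` otherwise. -/
noncomputable def gGamma (α β : ℝ) (s : ℝ) : ℝ :=
  if 0 < s then (α / s) * Real.exp (-β * s) else 0

/-- The two-dimensional heat kernel `p₂(s,u) = (2πs)^{−1}·e^{−|u|²/(2s)}` for `s > 0`. -/
noncomputable def p2 (s : ℝ) (u : ℝ × ℝ) : ℝ :=
  if 0 < s then (2 * Real.pi * s)⁻¹ * Real.exp (-(u.1 ^ 2 + u.2 ^ 2) / (2 * s)) else 0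

/-- The measure `ν₂` on `ℝ³ = ℝ × ℝ²` with density `(s,u) ↦ g_γ(s)·p₂(s,u)` w.r.t. Lebesgue
measure. -/
noncomputable def nu2 (α β : ℝ) : Measure (ℝ × ℝ × ℝ) :=
  (volume : Measure (ℝ × ℝ × ℝ)).withDensity fun q =>
    ENNReal.ofReal (gGamma α β q.1 * p2 q.1 q.2)

/-- The indicator function `1_{(0,∞)}`. -/
noncomputable def indPos (x : ℝ) : ℝ := if 0 < x then 1 else 0

/-- First (variance) component of the jump coefficient of the coupled
variance/foreign-rate system:
`g₁(s,u,x) = θ_v·s·1_{(0,∞)}(s) + σ_v·u₁·√x₁·1_{(0,∞)}(x₁)`. -/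
noncomputable def gVc (θv σv : ℝ) (s : ℝ) (u x : ℝ × ℝ) : ℝ :=
  θv * s * indPos s + σv * u.1 * Real.sqrt x.1 * indPos x.1

/-- Second (foreign-rate) component of the jump coefficient of the coupled
variance/foreign-rate system:
`g₂(s,u,x) = θ_f·s·1_{(0,∞)}(s) + σ_f·ρ_{vf}·u₁·√x₂·1_{(0,∞)}(x₂)
  + σ_f·√(1−ρ_{vf}²)·u₂·√x₂·1_{(0,∞)}(x₂)`. -/
noncomputable def gFc (θf σf ρvf : ℝ) (s : ℝ) (u x : ℝ × ℝ) : ℝ :=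
  θf * s * indPos s + σf * ρvf * u.1 * Real.sqrt x.2 * indPos x.2 +
    σf * Real.sqrt (1 - ρvf ^ 2) * u.2 * Real.sqrt x.2 * indPos x.2

lemma mul_exp_neg_le_exp_neg_half {c : ℝ} (hc : 0 < c) (t : ℝ) :
    t * exp (-(c * t)) ≤ 2 / c * exp (-(c / 2 * t)) := by
  have h1 : c / 2 * t ≤ exp (c / 2 * t) := by linarith [add_one_le_exp (c / 2 * t)]
  have h2 : exp (-(c * t)) = exp (-(c / 2 * t)) * exp (-(c / 2 * t)) := by
    rw [← exp_add]; congr 1; ring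
  have h3 : exp (c / 2 * t) * exp (-(c / 2 * t)) = 1 := by rw [← exp_add]; simp
  have h4 : c / 2 * t * exp (-(c / 2 * t)) ≤ 1 := by
    rw [← h3]; exact mul_le_mul_of_nonneg_right h1 (exp_pos _).le
  calc t * exp (-(c * t))
      = 2 / c * ((c / 2 * t * exp (-(c / 2 * t))) * exp (-(c / 2 * t))) := by
        rw [h2]; field_simp
    _ ≤ 2 / c * (1 * exp (-(c / 2 * t))) := by gcongr
    _ = _ := by ring

lemma sq_sqrt_mul_indPos_le_abs (x : ℝ) : (√x * indPos x) ^ 2 ≤ |x| := by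
  unfold indPos
  split_ifs with h
  · rw [mul_one, sq_sqrt h.le]; exact le_abs_self x
  · simp

lemma sq_mul_indPos_le_sq (s : ℝ) : (s * indPos s) ^ 2 ≤ s ^ 2 := by
  unfold indPos; split_ifs <;> simp [sq_nonneg]

lemma sq_gVc_le (θv σv s : ℝ) (u x : ℝ × ℝ) :
    gVc θv σv s u x ^ 2 ≤ 2 * θv ^ 2 * s ^ 2 + 2 * σv ^ 2 * (u.1 ^ 2 * |x.1|) := by
  have h1 := mul_le_mul_of_nonneg_left (sq_mul_indPos_le_sq s) (sq_nonneg θv)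
  have h2 := mul_le_mul_of_nonneg_left (sq_sqrt_mul_indPos_le_abs x.1) (sq_nonneg (σv * u.1))
  have h3 := sq_nonneg (θv * (s * indPos s) - σv * u.1 * (√x.1 * indPos x.1))
  unfold gVc
  nlinarith

lemma sq_gFc_le (θf σf s : ℝ) {ρvf : ℝ} (hρ : ρvf ∈ Ioo (-1 : ℝ) 1) (u x : ℝ × ℝ) :
    gFc θf σf ρvf s u x ^ 2 ≤
      2 * θf ^ 2 * s ^ 2 + 2 * σf ^ 2 * ((u.1 ^ 2 + u.2 ^ 2) * |x.2|) := by
  have hr : √(1 - ρvf ^ 2) ^ 2 = 1 - ρvf ^ 2 := sq_sqrt (by nlinarith [hρ.1, hρ.2])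
  unfold gFc
  generalize √(1 - ρvf ^ 2) = r at hr
  have h1 := mul_le_mul_of_nonneg_left (sq_mul_indPos_le_sq s) (sq_nonneg θf)
  have hu : (ρvf * u.1 + r * u.2) ^ 2 ≤ u.1 ^ 2 + u.2 ^ 2 := by
    have := sq_nonneg (r * u.1 - ρvf * u.2)
    have : (ρvf * u.1 + r * u.2) ^ 2 + (r * u.1 - ρvf * u.2) ^ 2 = u.1 ^ 2 + u.2 ^ 2 := by
      linear_combination (u.1 ^ 2 + u.2 ^ 2) * hr
    linarith
  have h2 := mul_le_mul_of_nonneg_left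
    (mul_le_mul hu (sq_sqrt_mul_indPos_le_abs x.2) (sq_nonneg _) (by positivity)) (sq_nonneg σf)
  have h3 := sq_nonneg
    (θf * (s * indPos s) - σf * (ρvf * u.1 + r * u.2) * (√x.2 * indPos x.2))
  nlinarith

lemma sq_gVc_add_sq_gFc_le (θv σv θf σf s : ℝ) {ρvf : ℝ} (hρ : ρvf ∈ Ioo (-1 : ℝ) 1)
    (u x : ℝ × ℝ) :
    gVc θv σv s u x ^ 2 + gFc θf σf ρvf s u x ^ 2 ≤
      2 * (θv ^ 2 + σv ^ 2 + θf ^ 2 + σf ^ 2) * (1 + (x.1 ^ 2 + x.2 ^ 2)) *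
        (s ^ 2 + (u.1 ^ 2 + u.2 ^ 2)) := by
  set N := 1 + (x.1 ^ 2 + x.2 ^ 2) with hN
  set Q := s ^ 2 + (u.1 ^ 2 + u.2 ^ 2) with hQ
  have hQ0 : 0 ≤ Q := by positivity
  have hN1 : 1 ≤ N := by nlinarith [sq_nonneg x.1, sq_nonneg x.2]
  have hx1 : |x.1| ≤ N := by
    nlinarith [sq_abs x.1, sq_nonneg (|x.1| - 1), sq_nonneg x.2, abs_nonneg x.1]
  have hx2 : |x.2| ≤ N := by
    nlinarith [sq_abs x.2, sq_nonneg (|x.2| - 1), sq_nonneg x.1, abs_nonneg x.2]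
  have hs : s ^ 2 ≤ Q * N := by
    have : s ^ 2 ≤ Q := by nlinarith [sq_nonneg u.1, sq_nonneg u.2]
    nlinarith
  have hu1 : u.1 ^ 2 * |x.1| ≤ Q * N :=
    mul_le_mul (by nlinarith [sq_nonneg s, sq_nonneg u.2]) hx1 (abs_nonneg _) hQ0
  have hu2 : (u.1 ^ 2 + u.2 ^ 2) * |x.2| ≤ Q * N :=
    mul_le_mul (by nlinarith [sq_nonneg s]) hx2 (abs_nonneg _) hQ0
  have := mul_le_mul_of_nonneg_left hs (sq_nonneg θv)
  have := mul_le_mul_of_nonneg_left hs (sq_nonneg θf)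
  have := mul_le_mul_of_nonneg_left hu1 (sq_nonneg σv)
  have := mul_le_mul_of_nonneg_left hu2 (sq_nonneg σf)
  nlinarith [sq_gVc_le θv σv s u x, sq_gFc_le θf σf s hρ u x]

lemma gGamma_mul_p2_mul_sq_le {α β s : ℝ} (hα : 0 < α) (hβ : 0 < β) (hs : 0 < s) (u : ℝ × ℝ) :
    gGamma α β s * p2 s u * (s ^ 2 + (u.1 ^ 2 + u.2 ^ 2)) ≤
      α * (2 / β + 4) / (2 * π * s) * exp (-(β / 2 * s)) *
        (exp (-(4 * s)⁻¹ * u.1 ^ 2) * exp (-(4 * s)⁻¹ * u.2 ^ 2)) := by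
  set r := u.1 ^ 2 + u.2 ^ 2 with hr
  have hr0 : 0 ≤ r := by positivity
  set E := exp (-(4 * s)⁻¹ * u.1 ^ 2) * exp (-(4 * s)⁻¹ * u.2 ^ 2) with hE
  have hE' : E = exp (-((4 * s)⁻¹ * r)) := by
    rw [hE, ← exp_add, hr]; congr 1; ring
  have hE0 : 0 < E := by positivity
  have hD : exp (-r / (2 * s)) ≤ E := by
    rw [hE', exp_le_exp]
    have : -r / (2 * s) = -((4 * s)⁻¹ * r) - (4 * s)⁻¹ * r := by field_simp; ring
    have : 0 ≤ (4 * s)⁻¹ * r := by positivity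
    linarith
  have hrD : r * exp (-r / (2 * s)) ≤ 4 * s * E := by
    have h := mul_exp_neg_le_exp_neg_half (c := (2 * s)⁻¹) (by positivity) r
    have e1 : -((2 * s)⁻¹ * r) = -r / (2 * s) := by field_simp
    have e2 : (2 * s)⁻¹ / 2 = (4 * s)⁻¹ := by field_simp; norm_num
    have e3 : 2 / (2 * s)⁻¹ = 4 * s := by field_simp; norm_num
    rwa [e1, e2, e3, ← hE'] at h
  have hG : s * exp (-(β * s)) ≤ 2 / β * exp (-(β / 2 * s)) := mul_exp_neg_le_exp_neg_half hβ s
  have hG' : exp (-(β * s)) ≤ exp (-(β / 2 * s)) := by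
    rw [exp_le_exp]; nlinarith [mul_pos hβ hs]
  rw [gGamma, p2, if_pos hs, if_pos hs, neg_mul]
  calc α / s * exp (-(β * s)) * ((2 * π * s)⁻¹ * exp (-r / (2 * s))) * (s ^ 2 + r)
      = α / s * (2 * π * s)⁻¹ * exp (-(β * s)) *
          (s ^ 2 * exp (-r / (2 * s)) + r * exp (-r / (2 * s))) := by ring
    _ ≤ α / s * (2 * π * s)⁻¹ * exp (-(β * s)) * (s ^ 2 * E + 4 * s * E) := by gcongr
    _ = α * (2 * π * s)⁻¹ * (s * exp (-(β * s)) + 4 * exp (-(β * s))) * E := by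
        field_simp
    _ ≤ α * (2 * π * s)⁻¹ * (2 / β * exp (-(β / 2 * s)) + 4 * exp (-(β / 2 * s))) * E := by
        gcongr
    _ = _ := by ring

lemma lintegral_exp_neg_mul_sq {b : ℝ} (hb : 0 < b) :
    ∫⁻ y : ℝ, ENNReal.ofReal (exp (-b * y ^ 2)) = ENNReal.ofReal √(π / b) := by
  rw [← integral_gaussian, ofReal_integral_eq_lintegral_ofReal (integrable_exp_neg_mul_sq hb)
    (Filter.Eventually.of_forall fun _ => (exp_pos _).le)]

lemma lintegral_gGamma_mul_p2_mul_sq_le {α β s : ℝ} (hα : 0 < α) (hβ : 0 < β) (hs : 0 < s) :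
    ∫⁻ u : ℝ × ℝ, ENNReal.ofReal (gGamma α β s * p2 s u * (s ^ 2 + (u.1 ^ 2 + u.2 ^ 2))) ≤
      ENNReal.ofReal (2 * α * (2 / β + 4) * exp (-(β / 2) * s)) := by
  have hb : 0 < (4 * s)⁻¹ := by positivity
  calc ∫⁻ u : ℝ × ℝ, ENNReal.ofReal (gGamma α β s * p2 s u * (s ^ 2 + (u.1 ^ 2 + u.2 ^ 2)))
      ≤ ∫⁻ u : ℝ × ℝ, ENNReal.ofReal (α * (2 / β + 4) / (2 * π * s) * exp (-(β / 2 * s))) *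
          (ENNReal.ofReal (exp (-(4 * s)⁻¹ * u.1 ^ 2)) *
            ENNReal.ofReal (exp (-(4 * s)⁻¹ * u.2 ^ 2))) := by
        refine lintegral_mono fun u => ?_
        rw [← ENNReal.ofReal_mul (exp_pos _).le, ← ENNReal.ofReal_mul (by positivity)]
        exact ENNReal.ofReal_le_ofReal (gGamma_mul_p2_mul_sq_le hα hβ hs u)
    _ = ENNReal.ofReal (α * (2 / β + 4) / (2 * π * s) * exp (-(β / 2 * s))) *
          (ENNReal.ofReal √(π / (4 * s)⁻¹) * ENNReal.ofReal √(π / (4 * s)⁻¹)) := by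
        rw [lintegral_const_mul _ (by fun_prop), Measure.volume_eq_prod,
          lintegral_prod_mul (f := fun y : ℝ => ENNReal.ofReal (exp (-(4 * s)⁻¹ * y ^ 2)))
            (g := fun y : ℝ => ENNReal.ofReal (exp (-(4 * s)⁻¹ * y ^ 2)))
            (by fun_prop) (by fun_prop), lintegral_exp_neg_mul_sq hb]
    _ = _ := by
        rw [← ENNReal.ofReal_mul (sqrt_nonneg _), ← ENNReal.ofReal_mul (by positivity),
          mul_self_sqrt (by positivity)]
        congr 1
        rw [neg_mul]
        field_simp
        norm_num

@[fun_prop]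
lemma measurable_gGamma (α β : ℝ) : Measurable (gGamma α β) := by
  unfold gGamma
  exact Measurable.ite (measurableSet_lt measurable_const measurable_id) (by fun_prop)
    measurable_const

@[fun_prop]
lemma measurable_p2 : Measurable fun q : ℝ × ℝ × ℝ => p2 q.1 q.2 := by
  unfold p2
  exact Measurable.ite (measurableSet_lt measurable_const measurable_fst) (by fun_prop)
    measurable_const

lemma gGamma_mul_p2_nonneg {α : ℝ} (hα : 0 < α) (β s : ℝ) (u : ℝ × ℝ) :
    0 ≤ gGamma α β s * p2 s u := by
  unfold gGamma p2
  split_ifs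
  · positivity
  · simp

/-- The measure `ν₂` has a finite second moment. -/
lemma lintegral_sq_nu2_lt_top {α β : ℝ} (hα : 0 < α) (hβ : 0 < β) :
    ∫⁻ q : ℝ × ℝ × ℝ, ENNReal.ofReal (q.1 ^ 2 + (q.2.1 ^ 2 + q.2.2 ^ 2)) ∂nu2 α β < ⊤ := by
  have hint : IntegrableOn (fun s => 2 * α * (2 / β + 4) * exp (-(β / 2) * s)) (Ioi 0) :=
    (exp_neg_integrableOn_Ioi 0 (half_pos hβ)).const_mul _
  calc ∫⁻ q : ℝ × ℝ × ℝ, ENNReal.ofReal (q.1 ^ 2 + (q.2.1 ^ 2 + q.2.2 ^ 2)) ∂nu2 α β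
      = ∫⁻ q : ℝ × ℝ × ℝ, ENNReal.ofReal
          (gGamma α β q.1 * p2 q.1 q.2 * (q.1 ^ 2 + (q.2.1 ^ 2 + q.2.2 ^ 2))) := by
        rw [nu2, lintegral_withDensity_eq_lintegral_mul _ (by fun_prop) (by fun_prop)]
        refine lintegral_congr fun q => ?_
        rw [Pi.mul_apply, ← ENNReal.ofReal_mul (gGamma_mul_p2_nonneg hα _ _ _)]
    _ = ∫⁻ s : ℝ, ∫⁻ u : ℝ × ℝ,
          ENNReal.ofReal (gGamma α β s * p2 s u * (s ^ 2 + (u.1 ^ 2 + u.2 ^ 2))) := by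
        rw [Measure.volume_eq_prod, lintegral_prod _ (by fun_prop)]
    _ ≤ ∫⁻ s : ℝ, (Ioi 0).indicator
          (fun s => ENNReal.ofReal (2 * α * (2 / β + 4) * exp (-(β / 2) * s))) s := by
        refine lintegral_mono fun s => ?_
        by_cases hs : 0 < s
        · rw [indicator_of_mem (mem_Ioi.2 hs)]
          exact lintegral_gGamma_mul_p2_mul_sq_le hα hβ hs
        · simp [gGamma, hs]
    _ = ∫⁻ s in Ioi 0, ENNReal.ofReal (2 * α * (2 / β + 4) * exp (-(β / 2) * s)) :=
        lintegral_indicator measurableSet_Ioi _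
    _ < ⊤ := hint.lintegral_lt_top

lemma abs_mul_sqrt_mul_indPos_min_le (x y : ℝ) :
    |y * (√(x * y) * indPos (min x y))| ≤ x ^ 2 + y ^ 2 := by
  unfold indPos
  split_ifs with h
  · obtain ⟨hx, hy⟩ := lt_min_iff.1 h
    have hxy : 0 ≤ x * y := (mul_pos hx hy).le
    have : √(x * y) ≤ (x + y) / 2 := by
      rw [sqrt_le_left (by positivity)]
      nlinarith [sq_nonneg (x - y)]
    rw [mul_one, abs_of_nonneg (by positivity)]
    nlinarith [mul_le_mul_of_nonneg_left this hy.le, sq_nonneg (x - y), sq_nonneg x]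
  · simp only [mul_zero, abs_zero]; positivity

lemma two_mul_inner_drift_le {κv av κf af σf ρsf : ℝ} (hκv : 0 < κv) (hav : 0 < av)
    (hκf : 0 < κf) (haf : 0 < af) (hσf : 0 < σf) (hρsf : ρsf ∈ Ioo (-1 : ℝ) 1) (x : ℝ × ℝ) :
    2 * (x.1 * (κv * (av - x.1)) +
        x.2 * (κf * (af - x.2) - σf * ρsf * √(x.1 * x.2) * indPos (min x.1 x.2))) ≤
      (κv * av + κf * af + 2 * σf) * (1 + (x.1 ^ 2 + x.2 ^ 2)) := by
  set w := x.2 * (√(x.1 * x.2) * indPos (min x.1 x.2)) with hw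
  have hρw : -(ρsf * w) ≤ x.1 ^ 2 + x.2 ^ 2 := by
    calc -(ρsf * w) ≤ |ρsf * w| := neg_le_abs _
      _ = |ρsf| * |w| := abs_mul _ _
      _ ≤ 1 * |w| := by gcongr; exact (abs_lt.2 hρsf).le
      _ ≤ x.1 ^ 2 + x.2 ^ 2 := by rw [one_mul]; exact abs_mul_sqrt_mul_indPos_min_le _ _
  have h1 := mul_le_mul_of_nonneg_left hρw hσf.le
  have h2 : κv * av * (2 * x.1) ≤ κv * av * (1 + (x.1 ^ 2 + x.2 ^ 2)) := by
    gcongr; nlinarith [sq_nonneg (x.1 - 1), sq_nonneg x.2]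
  have h3 : κf * af * (2 * x.2) ≤ κf * af * (1 + (x.1 ^ 2 + x.2 ^ 2)) := by
    gcongr; nlinarith [sq_nonneg (x.2 - 1), sq_nonneg x.1]
  have h4 : 0 ≤ κv * x.1 ^ 2 := by positivity
  have h5 : 0 ≤ κf * x.2 ^ 2 := by positivity
  have h6 : 2 * (x.1 * (κv * (av - x.1)) +
        x.2 * (κf * (af - x.2) - σf * ρsf * √(x.1 * x.2) * indPos (min x.1 x.2))) =
      κv * av * (2 * x.1) + κf * af * (2 * x.2) - 2 * (κv * x.1 ^ 2) - 2 * (κf * x.2 ^ 2) +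
        2 * (σf * -(ρsf * w)) := by rw [hw]; ring
  rw [h6]
  linarith

/-- The non-explosion growth condition for the coupled variance/foreign-rate system: with
drift `b(x) = (κ_v(a_v − x₁), κ_f(a_f − x₂) − σ_f·ρ_{sf}·√(x₁x₂)·1_{(0,∞)}(min(x₁,x₂)))` and
jump coefficient `g = (g₁, g₂)`, there is `C > 0` with
`2⟨x, b(x)⟩ + ∫_{ℝ³} |g(s,u,x)|² dν₂(s,u) ≤ C(1 + |x|²)` for every `x ∈ ℝ²`
(in particular the integral is finite). -/
theorem coupled_system_nonexplosion_growth (α β κv av σv θv κf af σf θf ρsf ρvf : ℝ)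
    (hα : 0 < α) (hβ : 0 < β) (hκv : 0 < κv) (hav : 0 < av) (hσv : 0 < σv)
    (hκf : 0 < κf) (haf : 0 < af) (hσf : 0 < σf) (hθv : 0 ≤ θv) (hθf : 0 ≤ θf)
    (hρsf : ρsf ∈ Set.Ioo (-1 : ℝ) 1) (hρvf : ρvf ∈ Set.Ioo (-1 : ℝ) 1) :
    ∃ C > 0, ∀ x : ℝ × ℝ,
      (∫⁻ q : ℝ × ℝ × ℝ,
          ENNReal.ofReal ((gVc θv σv q.1 q.2 x) ^ 2 + (gFc θf σf ρvf q.1 q.2 x) ^ 2)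
            ∂nu2 α β) < ⊤ ∧
      2 * (x.1 * (κv * (av - x.1)) +
            x.2 * (κf * (af - x.2) -
              σf * ρsf * Real.sqrt (x.1 * x.2) * indPos (min x.1 x.2))) +
          (∫⁻ q : ℝ × ℝ × ℝ,
            ENNReal.ofReal ((gVc θv σv q.1 q.2 x) ^ 2 + (gFc θf σf ρvf q.1 q.2 x) ^ 2)
              ∂nu2 α β).toReal ≤
        C * (1 + (x.1 ^ 2 + x.2 ^ 2)) := by
  set A := 2 * (θv ^ 2 + σv ^ 2 + θf ^ 2 + σf ^ 2) with hA
  have hA0 : 0 ≤ A := by positivity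
  set M := ∫⁻ q : ℝ × ℝ × ℝ, ENNReal.ofReal (q.1 ^ 2 + (q.2.1 ^ 2 + q.2.2 ^ 2)) ∂nu2 α β with hM
  have hMtop : M < ⊤ := lintegral_sq_nu2_lt_top hα hβ
  refine ⟨κv * av + κf * af + 2 * σf + A * M.toReal, by positivity, fun x => ?_⟩
  have hN : 0 ≤ 1 + (x.1 ^ 2 + x.2 ^ 2) := by positivity
  have hle : ∫⁻ q : ℝ × ℝ × ℝ,
      ENNReal.ofReal ((gVc θv σv q.1 q.2 x) ^ 2 + (gFc θf σf ρvf q.1 q.2 x) ^ 2) ∂nu2 α β ≤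
        ENNReal.ofReal (A * (1 + (x.1 ^ 2 + x.2 ^ 2))) * M := by
    rw [hM, ← lintegral_const_mul' _ _ ENNReal.ofReal_ne_top]
    refine lintegral_mono fun q => ?_
    rw [← ENNReal.ofReal_mul (mul_nonneg hA0 hN)]
    exact ENNReal.ofReal_le_ofReal (sq_gVc_add_sq_gFc_le θv σv θf σf q.1 hρvf q.2 x)
  have htop := ENNReal.mul_lt_top (ENNReal.ofReal_lt_top (r := A * (1 + (x.1 ^ 2 + x.2 ^ 2)))) hMtop
  refine ⟨hle.trans_lt htop, ?_⟩
  have hreal := ENNReal.toReal_mono htop.ne hle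
  rw [ENNReal.toReal_mul, ENNReal.toReal_ofReal (mul_nonneg hA0 hN)] at hreal
  calc _ ≤ (κv * av + κf * af + 2 * σf) * (1 + (x.1 ^ 2 + x.2 ^ 2)) +
        A * (1 + (x.1 ^ 2 + x.2 ^ 2)) * M.toReal :=
        add_le_add (two_mul_inner_drift_le hκv hav hκf haf hσf hρsf x) hreal
    _ = _ := by ring
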